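/- arXiv:1211.6607 — 2 statements merged into one kernel-verified Lean document; each statement's English description precedes it below -/
import Mathlib

section
/- Let G be a stratified group with homogeneous distance d, identified with ℝ^n by exponential coordinates adapted to a graded basis and with points written x = (x^1,…,x^ι) ∈ ℝ^{n_1} × … × ℝ^{n_ι}. There exists a constant C = C(d) > 0 with the following property: for every r ≤ 1, every x in the Euclidean ball B_E(0,r) and every j ∈ {1,…,ι}, there exists x̃ ∈ G such that x̃^1 = … = x̃^j = 0, d(x, x̃) ≤ C r^{1/j}, and |x̃^h − x^h| ≤ C r² for every h = j+1,…,ι. -/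
open Set Filter Function Module MeasureTheory
open scoped ENNReal Topology NNReal

noncomputable section

/-- A stratified (Carnot) group of step `ι`, identified with `ℝⁿ` through exponential
coordinates of the first kind adapted to a graded basis.  The coordinate `i` has degree
`deg i` (the index of the layer it belongs to); coordinates are ordered by layer.
The group operation is smooth, has the origin as identity, `-x` as inverse of `x`
(exponential coordinates of the first kind), satisfies the Baker-Campbell-Hausdorff
grading structure, is compatible with the dilations
`δ_r x = (r^{deg i} * x i)_i`, and the layers are bracket generating:
`V_{j+1} = [V_1, V_j]`. -/
structure StratifiedGroup where
  n : ℕ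
  ι : ℕ
  ι_pos : 0 < ι
  deg : Fin n → ℕ
  deg_pos : ∀ i, 1 ≤ deg i
  deg_le : ∀ i, deg i ≤ ι
  deg_surj : ∀ j, 1 ≤ j → j ≤ ι → ∃ i, deg i = j
  deg_mono : Monotone deg
  mul : (Fin n → ℝ) → (Fin n → ℝ) → (Fin n → ℝ)
  mul_assoc' : ∀ x y z, mul (mul x y) z = mul x (mul y z)
  zero_mul' : ∀ x, mul 0 x = x
  mul_zero' : ∀ x, mul x 0 = x
  mul_neg' : ∀ x, mul x (-x) = 0
  mul_smooth : ContDiff ℝ ⊤ fun q : (Fin n → ℝ) × (Fin n → ℝ) => mul q.1 q.2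
  mul_graded : ∀ x x' y y' : Fin n → ℝ, ∀ i : Fin n,
    (∀ k, deg k < deg i → x k = x' k ∧ y k = y' k) →
    mul x y i - x i - y i = mul x' y' i - x' i - y' i
  dil_mul : ∀ r : ℝ, 0 < r → ∀ x y : Fin n → ℝ, ∀ i : Fin n,
    mul (fun k => r ^ deg k * x k) (fun k => r ^ deg k * y k) i = r ^ deg i * mul x y i
  bracket_gen : ∀ j, 1 ≤ j → j < ι → ∀ w : Fin n → ℝ,
    (∀ i, deg i ≠ j + 1 → w i = 0) →
    w ∈ Submodule.span ℝ { z : Fin n → ℝ | ∃ u v : Fin n → ℝ,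
      (∀ i, deg i ≠ 1 → u i = 0) ∧ (∀ i, deg i ≠ j → v i = 0) ∧
      z = fun i => if deg i = j + 1 then mul u v i - u i - v i else 0 }

namespace StratifiedGroup

/-- The underlying space of the group, `ℝⁿ` in graded coordinates. -/
abbrev Pt (G : StratifiedGroup) : Type := Fin G.n → ℝ

variable (G : StratifiedGroup)

/-- The intrinsic dilation `δ_r`. -/
def dil (r : ℝ) (x : G.Pt) : G.Pt := fun i => r ^ G.deg i * x i

/-- Left translation `l_x`. -/
def lTrans (x : G.Pt) : G.Pt → G.Pt := fun y => G.mul x y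

/-- The left translate `x⁻¹ · S` of a set `S` (the inverse of `x` is `-x`). -/
def shift (x : G.Pt) (S : Set G.Pt) : Set G.Pt := (fun y => G.mul (-x) y) '' S

/-- `n_j`: the dimension of the `j`-th layer. -/
def nLayer (j : ℕ) : ℕ := (Finset.univ.filter fun i : Fin G.n => G.deg i = j).card

/-- `m_j = n_1 + ⋯ + n_j`. -/
def mVal (j : ℕ) : ℕ := (Finset.univ.filter fun i : Fin G.n => G.deg i ≤ j).card

/-- Projection onto the `j`-th layer of coordinates. -/
def layerProj (j : ℕ) (x : G.Pt) : G.Pt := fun i => if G.deg i = j then x i else 0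

/-- `D(p)`, the maximal dimension: the maximum of `d(α) = d_{α_1} + ⋯ + d_{α_p}` over
multi-indices `1 ≤ α_1 < ⋯ < α_p ≤ n`. -/
def maxDim (p : ℕ) : ℕ :=
  sSup {D : ℕ | ∃ α : Finset (Fin G.n), α.card = p ∧ D = ∑ i ∈ α, G.deg i}

/-- `ℓ(p)`: the largest `l ∈ [1, ι]` with `p ≤ n_l + ⋯ + n_ι`. -/
def ellVal (p : ℕ) : ℕ :=
  sSup {l : ℕ | 1 ≤ l ∧ l ≤ G.ι ∧ p ≤ ∑ j ∈ Finset.Icc l G.ι, G.nLayer j}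

/-- `r_p = p - (n_{ℓ(p)+1} + ⋯ + n_ι)`. -/
def rVal (p : ℕ) : ℕ := p - ∑ j ∈ Finset.Icc (G.ellVal p + 1) G.ι, G.nLayer j

/-- The tangent space `T_0(x⁻¹ · S)` of the translated set at the identity:
the span of the tangent cone at `0` of `x⁻¹ · S`. -/
def tangentAt (S : Set G.Pt) (x : G.Pt) : Submodule ℝ G.Pt :=
  Submodule.span ℝ (tangentConeAt ℝ (G.shift x S) 0)

/-- The pointwise degree `d_Σ(x)` of a `p`-dimensional set `Σ = S` at `x`: the maximal
`d(α)` over multi-indices `α` such that the coefficient `c_α` of the tangent `p`-vector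
is nonzero; equivalently, such that the projection of `T_0(x⁻¹·S)` onto the coordinates
in `α` is injective. -/
def pointDeg (p : ℕ) (S : Set G.Pt) (x : G.Pt) : ℕ :=
  sSup {D : ℕ | ∃ α : Finset (Fin G.n), α.card = p ∧
    (∀ v ∈ G.tangentAt S x, (∀ i ∈ α, v i = 0) → v = 0) ∧ D = ∑ i ∈ α, G.deg i}

/-- The generalized characteristic set `Σ_c`: points of degree less than `D(p)`. -/
def charSet (p : ℕ) (S : Set G.Pt) : Set G.Pt := {x ∈ S | G.pointDeg p S x < G.maxDim p}

end StratifiedGroup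

/-- A homogeneous distance on a stratified group: a continuous (for the Euclidean
topology) distance, left invariant and `1`-homogeneous with respect to dilations. -/
structure HomDistOn (G : StratifiedGroup) where
  d : G.Pt → G.Pt → ℝ
  symm : ∀ x y, d x y = d y x
  triangle : ∀ x y z, d x z ≤ d x y + d y z
  eq_zero_iff : ∀ x y, d x y = 0 ↔ x = y
  continuous : Continuous fun q : G.Pt × G.Pt => d q.1 q.2
  left_invariant : ∀ x y z, d (G.mul z x) (G.mul z y) = d x y
  homogeneous : ∀ r : ℝ, 0 < r → ∀ x y, d (G.dil r x) (G.dil r y) = r * d x y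

/-- The open ball of a homogeneous distance. -/
def HomDistOn.ball {G : StratifiedGroup} (D : HomDistOn G) (x : G.Pt) (r : ℝ) : Set G.Pt :=
  {y | D.d x y < r}

/-- Euclidean norm on `ℝⁿ` (the graded coordinates are orthonormal). -/
def eNorm {n : ℕ} (x : Fin n → ℝ) : ℝ := Real.sqrt (∑ i, x i ^ 2)

/-- Euclidean scalar product. -/
def eDot {n : ℕ} (x y : Fin n → ℝ) : ℝ := ∑ i, x i * y i

/-- Euclidean distance. -/
def euclDist {n : ℕ} (x y : Fin n → ℝ) : ℝ := eNorm (x - y)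

/-- Euclidean open ball `B_E(x, r)`. -/
def eBall {n : ℕ} (x : Fin n → ℝ) (r : ℝ) : Set (Fin n → ℝ) := {y | eNorm (y - x) < r}

/-- Diameter of a set with respect to a distance function. -/
def sdiam {α : Type*} (dist : α → α → ℝ) (A : Set α) : ℝ≥0∞ :=
  ⨆ x ∈ A, ⨆ y ∈ A, ENNReal.ofReal (dist x y)

/-- The `q`-dimensional Hausdorff measure built from the distance `dist`. -/
def hMeas {α : Type*} (dist : α → α → ℝ) (q : ℝ) (A : Set α) : ℝ≥0∞ :=
  ⨆ (δ : ℝ≥0∞) (_ : 0 < δ),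
    ⨅ (t : ℕ → Set α) (_ : A ⊆ ⋃ i, t i) (_ : ∀ i, sdiam dist (t i) ≤ δ),
      ∑' i, sdiam dist (t i) ^ q

/-- The Hausdorff dimension built from the distance `dist`:
`inf {q ≥ 0 : H^q(A) = 0}` (`∞` if there is no such exponent). -/
def hDim {α : Type*} (dist : α → α → ℝ) (A : Set α) : ℝ≥0∞ :=
  sInf {q : ℝ≥0∞ | ∃ q' : ℝ, 0 ≤ q' ∧ q = ENNReal.ofReal q' ∧ hMeas dist q' A = 0}

/-- Hausdorff distance between two sets, with respect to a distance function. -/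
def hdDist {α : Type*} (dist : α → α → ℝ) (A B : Set α) : ℝ≥0∞ :=
  max (⨆ a ∈ A, ⨅ b ∈ B, ENNReal.ofReal (dist a b))
      (⨆ b ∈ B, ⨅ a ∈ A, ENNReal.ofReal (dist a b))

/-- `(V, φ)` is a `C¹` chart (local parametrization) of the `p`-dimensional submanifold
`S ⊆ ℝⁿ`: `φ` is a `C¹` injective immersion on the open set `V`, and it is an open map
onto (a relatively open piece of) `S`. -/
def IsC1Chart (n p : ℕ) (S : Set (Fin n → ℝ)) (V : Set (Fin p → ℝ))
    (φ : (Fin p → ℝ) → Fin n → ℝ) : Prop :=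
  IsOpen V ∧ ContDiffOn ℝ 1 φ V ∧ Set.InjOn φ V ∧
  (∀ t ∈ V, Function.Injective (fderivWithin ℝ φ V t)) ∧
  (∀ W, W ⊆ V → IsOpen W → ∃ O : Set (Fin n → ℝ), IsOpen O ∧ φ '' W = S ∩ O)

/-- `S ⊆ ℝⁿ` is a `p`-dimensional `C¹` submanifold. -/
def IsC1Submanifold (n p : ℕ) (S : Set (Fin n → ℝ)) : Prop :=
  ∀ x ∈ S, ∃ V φ, IsC1Chart n p S V φ ∧ x ∈ φ '' V

/-- A `C^{1,λ}` chart: a `C¹` chart whose differential is locally `λ`-Hölder continuous. -/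
def IsHolderChart (n p : ℕ) (la : ℝ) (S : Set (Fin n → ℝ)) (V : Set (Fin p → ℝ))
    (φ : (Fin p → ℝ) → Fin n → ℝ) : Prop :=
  IsC1Chart n p S V φ ∧
  ∀ K : Set (Fin p → ℝ), IsCompact K → K ⊆ V → ∃ C : ℝ, ∀ s ∈ K, ∀ t ∈ K,
    ‖fderivWithin ℝ φ V s - fderivWithin ℝ φ V t‖ ≤ C * ‖s - t‖ ^ la

/-- `S ⊆ ℝⁿ` is a `p`-dimensional submanifold of class `C^{1,λ}`. -/
def IsC1HolderSubmanifold (n p : ℕ) (la : ℝ) (S : Set (Fin n → ℝ)) : Prop :=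
  ∀ x ∈ S, ∃ V φ, IsHolderChart n p la S V φ ∧ x ∈ φ '' V

/-- `S ⊆ ℝⁿ` is a `p`-dimensional Lipschitz submanifold: locally the graph of a
Euclidean Lipschitz map from a `p`-dimensional subspace to a complement. -/
def IsLipschitzSubmanifold (n p : ℕ) (S : Set (Fin n → ℝ)) : Prop :=
  ∀ x ∈ S, ∃ (U : Set (Fin n → ℝ)) (W V' : Submodule ℝ (Fin n → ℝ))
    (f : W → (Fin n → ℝ)) (A : Set W),
    IsOpen U ∧ x ∈ U ∧ IsCompl W V' ∧ Module.finrank ℝ W = p ∧ IsOpen A ∧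
    (∃ K : ℝ≥0, LipschitzWith K f) ∧ (∀ w, f w ∈ V') ∧
    S ∩ U = (fun w : W => (w : Fin n → ℝ) + f w) '' A

/-- The singular set `Σ_*` of a `p`-dimensional set: the points where the Euclidean
tangent cone is not a `p`-dimensional subspace. -/
def singularSet (n p : ℕ) (S : Set (Fin n → ℝ)) : Set (Fin n → ℝ) :=
  {x ∈ S | ¬ ∃ T : Submodule ℝ (Fin n → ℝ), Module.finrank ℝ T = p ∧
    tangentConeAt ℝ S x = (T : Set (Fin n → ℝ))}

/-- The subspace of `ℝⁿ` of vectors supported on the coordinates in `s`. -/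
def coordSubmodule (n : ℕ) (s : Set (Fin n)) : Submodule ℝ (Fin n → ℝ) where
  carrier := {v | ∀ i, i ∉ s → v i = 0}
  add_mem' := by
    intro a b ha hb i hi
    simp [Pi.add_apply, ha i hi, hb i hi]
  zero_mem' := by intro i _; rfl
  smul_mem' := by
    intro c a ha i hi
    simp [Pi.smul_apply, ha i hi]

/-- The Plücker coordinates (with respect to the standard basis of `Λ_p ℝⁿ`) of the
`p`-vector `v_1 ∧ ⋯ ∧ v_p`: the coordinate indexed by the multi-index `α` (a subset of
cardinality `p`, enumerated increasingly) is the determinant of the corresponding minor. -/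
def pluckerC {n p : ℕ} (v : Fin p → Fin n → ℝ) (α : Finset (Fin n)) : ℝ :=
  if h : α.card = p then
    Matrix.det (Matrix.of fun a b : Fin p => v b (α.orderIsoOfFin h a).1)
  else 0

/-- The projection `π_D` of degree `D` of a `p`-vector given in coordinates: it keeps
only the coefficients `c_α` with `d(α) = D`. -/
def projDegC {n : ℕ} (deg : Fin n → ℕ) (D : ℕ) (c : Finset (Fin n) → ℝ) :
    Finset (Fin n) → ℝ :=
  fun α => if (∑ i ∈ α, deg i) = D then c α else 0

/-- The norm of a `p`-vector in coordinates (the standard basis of `Λ_p ℝⁿ` being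
orthonormal for the graded metric). -/
def pvecNorm {n : ℕ} (c : Finset (Fin n) → ℝ) : ℝ :=
  Real.sqrt (∑ α : Finset (Fin n), (c α) ^ 2)

/-- Coefficients of the wedge product `u ∧ c` of a vector with a `p`-vector. -/
def wedgeVec {n : ℕ} (c : Finset (Fin n) → ℝ) (u : Fin n → ℝ) (β : Finset (Fin n)) : ℝ :=
  ∑ i ∈ β, (-1 : ℝ) ^ (β.filter fun j => j < i).card * u i * c (β.erase i)

/-- The subspace associated with a simple `p`-vector `c`: vectors whose wedge with `c`
vanishes. -/
def pvecSpan {n : ℕ} (p : ℕ) (c : Finset (Fin n) → ℝ) : Set (Fin n → ℝ) :=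
  {u | ∀ β : Finset (Fin n), β.card = p + 1 → wedgeVec c u β = 0}

/-- A Riemannian metric on `ℝⁿ`: a continuous family of inner products. -/
structure RiemannMetric (n : ℕ) where
  g : (Fin n → ℝ) → (Fin n → ℝ) → (Fin n → ℝ) → ℝ
  symm : ∀ x u v, g x u v = g x v u
  lin : ∀ x v, IsLinearMap ℝ fun u => g x u v
  posdef : ∀ x u, u ≠ 0 → 0 < g x u u
  cont : Continuous fun q : (Fin n → ℝ) × (Fin n → ℝ) × (Fin n → ℝ) => g q.1 q.2.1 q.2.2

/-- The Gram determinant of the partial derivatives of a chart `φ` at `t`, with respect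
to a Riemannian metric: the square of the Riemannian surface density. -/
def gramDet {n p : ℕ} (gt : RiemannMetric n) (φ : (Fin p → ℝ) → Fin n → ℝ)
    (V : Set (Fin p → ℝ)) (t : Fin p → ℝ) : ℝ :=
  Matrix.det (Matrix.of fun j k : Fin p =>
    gt.g (φ t) (fderivWithin ℝ φ V t (Pi.single j 1)) (fderivWithin ℝ φ V t (Pi.single k 1)))

/-- The tangent `p`-tuple of a chart `φ` at `t₀`, left translated to the identity:
`(dl_{φ(t₀)⁻¹})(∂_{t_j} φ(t₀))`. -/
def tangentBasisT (G : StratifiedGroup) {p : ℕ} (V : Set (Fin p → ℝ))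
    (φ : (Fin p → ℝ) → G.Pt) (t0 : Fin p → ℝ) : Fin p → G.Pt :=
  fun j => fderiv ℝ (G.lTrans (-(φ t0))) (φ t0) (fderivWithin ℝ φ V t0 (Pi.single j 1))

/-- The density of the intrinsic measure in a chart:
`‖(∂_{t_1} φ ∧ ⋯ ∧ ∂_{t_p} φ)_{D, φ(t)}‖`. -/
def intIntegrand (G : StratifiedGroup) {p : ℕ} (D : ℕ) (V : Set (Fin p → ℝ))
    (φ : (Fin p → ℝ) → G.Pt) (t : Fin p → ℝ) : ℝ :=
  pvecNorm (projDegC G.deg D (pluckerC (tangentBasisT G V φ t)))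

/-- Cumulative sums `μ_k = α_1 + ⋯ + α_k`. -/
def cumsum (α : ℕ → ℕ) (k : ℕ) : ℕ := ∑ l ∈ Finset.Icc 1 k, α l

/-- The coefficient matrix `C` of the vectors `v_j` of `T_x Σ` with respect to the graded
basis `X_i` determined by the orthogonal layer-preserving matrix `U`:
`v_j = ∑_i C_{ij} X_i(x)`, i.e. `C_{ij} = ⟨U_{·i}, dl_{x⁻¹}(v_j)⟩`. -/
def Cmat (G : StratifiedGroup) {p : ℕ} (U : Matrix (Fin G.n) (Fin G.n) ℝ)
    (v : Fin p → G.Pt) (x : G.Pt) (i : Fin G.n) (j : Fin p) : ℝ :=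
  ∑ k, U k i * fderiv ℝ (G.lTrans (-x)) x (v j) k

/-- The intrinsic integers `α_k(x)` attached to a point of a submanifold:
`α_k = dim F_k - dim F_{k+1}` where `F_k` is the subspace of the (translated) tangent
space of vectors supported in the layers of degree `≥ k`. -/
def alphaOf (G : StratifiedGroup) (p : ℕ) (S : Set G.Pt) (x : G.Pt) (k : ℕ) : ℕ :=
  Module.finrank ℝ ↥(G.tangentAt S x ⊓ coordSubmodule G.n {i | k ≤ G.deg i}) -
  Module.finrank ℝ ↥(G.tangentAt S x ⊓ coordSubmodule G.n {i | k + 1 ≤ G.deg i})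

/-- The part `Σ_{c,A}` of the generalized characteristic set. -/
def charSetA (G : StratifiedGroup) (p : ℕ) (S : Set G.Pt) : Set G.Pt :=
  {x ∈ G.charSet p S | ∃ j, G.ellVal p + 1 ≤ j ∧ j ≤ G.ι ∧ alphaOf G p S x j < G.nLayer j}

/-- The part `Σ_{c,B}` of the generalized characteristic set. -/
def charSetB (G : StratifiedGroup) (p : ℕ) (S : Set G.Pt) : Set G.Pt :=
  {x ∈ G.charSet p S | (∀ j, G.ellVal p + 1 ≤ j → j ≤ G.ι → alphaOf G p S x j = G.nLayer j)
    ∧ alphaOf G p S x (G.ellVal p) < G.rVal p}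

/-- The defining property of the threshold `r̄_ε`: for all `r < r̄_ε`, all `x ∈ S`, all
`y ∈ (x⁻¹·S) ∩ B_E(0,r)` and all unit vectors `w ⊥ T_0(x⁻¹·S)`, one has `|⟨y,w⟩| ≤ ε r`. -/
def RbarSpec (G : StratifiedGroup) (S : Set G.Pt) (ε rb : ℝ) : Prop :=
  0 < rb ∧ ∀ r : ℝ, 0 < r → r < rb → ∀ x ∈ S, ∀ y ∈ G.shift x S ∩ eBall 0 r,
    ∀ w : G.Pt, eNorm w = 1 → (∀ v ∈ G.tangentAt S x, eDot v w = 0) → |eDot y w| ≤ ε * r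

/-- `G` is (isomorphic to) the `n`-th Heisenberg group: step 2, horizontal layer of
dimension `2n`, one-dimensional center, nondegenerate bracket on the first layer. -/
def IsHeisenberg (G : StratifiedGroup) (n : ℕ) : Prop :=
  G.ι = 2 ∧ G.n = 2 * n + 1 ∧ G.nLayer 1 = 2 * n ∧ G.nLayer 2 = 1 ∧
  ∀ u : G.Pt, (∀ i, G.deg i ≠ 1 → u i = 0) → u ≠ 0 →
    ∃ v : G.Pt, (∀ i, G.deg i ≠ 1 → v i = 0) ∧
      ∃ i, G.deg i = 2 ∧ G.mul u v i - u i - v i ≠ 0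

end

lemma abs_le_eNorm {n : ℕ} (x : Fin n → ℝ) (i : Fin n) : |x i| ≤ eNorm x :=
  Real.abs_le_sqrt <|
    Finset.single_le_sum (f := fun i => x i ^ 2) (fun _ _ => sq_nonneg _) (Finset.mem_univ i)

lemma norm_le_eNorm {n : ℕ} (x : Fin n → ℝ) : ‖x‖ ≤ eNorm x :=
  (pi_norm_le_iff_of_nonneg (Real.sqrt_nonneg _)).2 fun i => abs_le_eNorm x i

lemma eNorm_le_of_forall_abs_le {n : ℕ} {x : Fin n → ℝ} {B : ℝ} (hB : 0 ≤ B)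
    (h : ∀ i, |x i| ≤ B) : eNorm x ≤ (n + 1) * B := by
  refine Real.sqrt_le_iff.2 ⟨by positivity, ?_⟩
  calc ∑ i, x i ^ 2 ≤ ∑ _i : Fin n, B ^ 2 :=
        Finset.sum_le_sum fun i _ => sq_le_sq' (abs_le.1 (h i)).1 (abs_le.1 (h i)).2
    _ = n * B ^ 2 := by simp
    _ ≤ ((n + 1) * B) ^ 2 := by
        have : 0 ≤ (n : ℝ) * B ^ 2 := by positivity
        nlinarith [mul_nonneg (Nat.cast_nonneg (α := ℝ) n) this, sq_nonneg B]

/-- A `C²` map vanishing on both axes is bounded on balls by the product of the norms. -/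
lemma exists_norm_le_mul_norm_of_vanish_axes {E F : Type*}
    [NormedAddCommGroup E] [NormedSpace ℝ E] [FiniteDimensional ℝ E]
    [NormedAddCommGroup F] [NormedSpace ℝ F] {f : E × E → F} (hf : ContDiff ℝ 2 f)
    (hleft : ∀ y, f (0, y) = 0) (hright : ∀ x, f (x, 0) = 0) (R : ℝ) :
    ∃ K : ℝ, 0 ≤ K ∧ ∀ x y, ‖x‖ ≤ R → ‖y‖ ≤ R → ‖f (x, y)‖ ≤ K * ‖x‖ * ‖y‖ := by
  have hf' : ContDiff ℝ 1 (fderiv ℝ f) := hf.fderiv_right (by norm_num)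
  obtain ⟨K, hK⟩ := (isCompact_closedBall (0 : E × E) R).exists_bound_of_continuousOn
    (hf'.continuous_fderiv one_ne_zero).continuousOn
  refine ⟨max K 0, le_max_right _ _, fun x y hx hy => ?_⟩
  have hR : 0 ≤ R := (norm_nonneg x).trans hx
  have hdf : ∀ z ∈ Metric.closedBall (0 : E) R,
      ‖fderiv ℝ f (x, z) - fderiv ℝ f (0, z)‖ ≤ max K 0 * ‖x‖ := by
    intro z hz
    have hz' : ‖z‖ ≤ R := by simpa using hz
    have := (convex_closedBall (0 : E × E) R).norm_image_sub_le_of_norm_fderiv_le (𝕜 := ℝ)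
      (f := fderiv ℝ f) (fun p _ => (hf'.differentiable one_ne_zero) p)
      (fun p hp => (hK p hp).trans (le_max_left K 0))
      (x := (0, z)) (y := (x, z)) (by simpa [Prod.norm_def, hR] using hz')
      (by simpa [Prod.norm_def] using ⟨hx, hz'⟩)
    simpa [Prod.norm_def] using this
  have hderiv : ∀ z, HasFDerivAt (fun z => f (x, z) - f (0, z))
      ((fderiv ℝ f (x, z) - fderiv ℝ f (0, z)).comp (ContinuousLinearMap.inr ℝ E E)) z := by
    intro z
    have hd := hf.differentiable two_ne_zero
    rw [ContinuousLinearMap.sub_comp]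
    exact ((hd (x, z)).hasFDerivAt.comp z (hasFDerivAt_prodMk_right x z)).sub
      ((hd (0, z)).hasFDerivAt.comp z (hasFDerivAt_prodMk_right 0 z))
  have hmv := (convex_closedBall (0 : E) R).norm_image_sub_le_of_norm_hasFDerivWithin_le (𝕜 := ℝ)
    (C := max K 0 * ‖x‖) (fun z _ => (hderiv z).hasFDerivWithinAt)
    (fun z hz => (ContinuousLinearMap.opNorm_comp_le _ _).trans <|
      (mul_le_of_le_one_right (norm_nonneg _)
        (ContinuousLinearMap.norm_inr_le_one ℝ E E)).trans (hdf z hz))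
    (x := 0) (y := y) (by simpa using hR) (by simpa using hy)
  simpa [hleft, hright] using hmv

namespace StratifiedGroup

variable (G : StratifiedGroup)

lemma exists_norm_mul_sub_le (R : ℝ) :
    ∃ K : ℝ, 0 ≤ K ∧ ∀ x y : G.Pt, ‖x‖ ≤ R → ‖y‖ ≤ R →
      ‖G.mul x y - x - y‖ ≤ K * ‖x‖ * ‖y‖ :=
  exists_norm_le_mul_norm_of_vanish_axes
    (f := fun q : G.Pt × G.Pt => G.mul q.1 q.2 - q.1 - q.2)
    (((G.mul_smooth.of_le le_top).sub contDiff_fst).sub contDiff_snd)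
    (fun y => by simp [G.zero_mul']) (fun x => by simp [G.mul_zero']) R

variable {G}

lemma mul_apply_of_vanish_below {x y : G.Pt} {i : Fin G.n}
    (h : ∀ k, G.deg k < G.deg i → x k = 0 ∧ y k = 0) : G.mul x y i = x i + y i := by
  have := G.mul_graded x 0 y 0 i h
  simp only [G.zero_mul', Pi.zero_apply, sub_zero] at this
  linarith

lemma norm_layerProj_le (k : ℕ) (x : G.Pt) : ‖G.layerProj k x‖ ≤ ‖x‖ := by
  refine (pi_norm_le_iff_of_nonneg (norm_nonneg _)).2 fun i => ?_
  by_cases h : G.deg i = k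
  · simpa [layerProj, h] using norm_le_pi_norm x i
  · simp [layerProj, h]

end StratifiedGroup

namespace HomDistOn

variable {G : StratifiedGroup} (D : HomDistOn G)

lemma d_self_mul (x v : G.Pt) : D.d x (G.mul x v) = D.d 0 v := by
  simpa [G.mul_zero'] using D.left_invariant 0 v x

lemma exists_d_zero_le_rpow (A : ℝ) :
    ∃ M : ℝ, 0 ≤ M ∧ ∀ k : ℕ, 1 ≤ k → ∀ r : ℝ, 0 < r → ∀ v : G.Pt,
      (∀ i, G.deg i ≠ k → v i = 0) → ‖v‖ ≤ A * r → D.d 0 v ≤ M * r ^ ((1 : ℝ) / k) := by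
  have hc : Continuous fun v : G.Pt => D.d 0 v :=
    D.continuous.comp (continuous_const.prodMk continuous_id)
  obtain ⟨M, hM⟩ := (isCompact_closedBall (0 : G.Pt) A).exists_bound_of_continuousOn
    hc.continuousOn
  refine ⟨max M 0, le_max_right _ _, fun k hk r hr v hv hvr => ?_⟩
  have hs : 0 < r ^ ((1 : ℝ) / k) := Real.rpow_pos_of_pos hr _
  have hpow : (r ^ ((1 : ℝ) / k)) ^ k = r := by
    rw [one_div, Real.rpow_inv_natCast_pow hr.le (by omega)]
  have hdil : G.dil (r ^ ((1 : ℝ) / k)) (r⁻¹ • v) = v := by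
    ext i
    by_cases h : G.deg i = k
    · simp only [StratifiedGroup.dil, h, hpow, Pi.smul_apply, smul_eq_mul]
      field_simp
    · simp [StratifiedGroup.dil, hv i h]
  have hzero : G.dil (r ^ ((1 : ℝ) / k)) 0 = 0 := by
    ext i
    simp [StratifiedGroup.dil]
  have hmem : r⁻¹ • v ∈ Metric.closedBall (0 : G.Pt) A := by
    rw [mem_closedBall_zero_iff, norm_smul, norm_inv, Real.norm_of_nonneg hr.le,
      inv_mul_le_iff₀ hr, mul_comm]
    exact hvr
  calc D.d 0 v = r ^ ((1 : ℝ) / k) * D.d 0 (r⁻¹ • v) := by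
        rw [← D.homogeneous _ hs, hdil, hzero]
    _ ≤ r ^ ((1 : ℝ) / k) * max M 0 := by
        gcongr
        exact (le_abs_self _).trans ((hM _ hmem).trans (le_max_left _ _))
    _ = max M 0 * r ^ ((1 : ℝ) / k) := mul_comm _ _

/-- The first `j` layers are killed one at a time: once the layers below `k` vanish, right
multiplication by the opposite of the `k`-th layer kills that layer and moves the higher ones
by a quadratic error. -/
lemma exists_vanish_first_layers (j : ℕ) :
    ∃ C : ℝ, 0 ≤ C ∧ ∀ r : ℝ, 0 < r → r ≤ 1 → ∀ x : G.Pt, ‖x‖ ≤ r →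
      ∃ xt : G.Pt, (∀ i, G.deg i ≤ j → xt i = 0) ∧
        (∀ k : ℕ, 1 ≤ k → j ≤ k → D.d x xt ≤ C * r ^ ((1 : ℝ) / k)) ∧
        ∀ i, j < G.deg i → |xt i - x i| ≤ C * r ^ 2 := by
  induction j with
  | zero =>
    refine ⟨0, le_rfl, fun r _ _ x _ => ⟨x, fun i hi => ?_, fun k _ _ => ?_, fun i _ => ?_⟩⟩
    · have := G.deg_pos i
      omega
    · simp [(D.eq_zero_iff x x).2 rfl]
    · simp
  | succ j ih =>
    obtain ⟨C, hC, ih⟩ := ih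
    obtain ⟨K, hK, hmul⟩ := G.exists_norm_mul_sub_le (C + 1)
    obtain ⟨M, hM, hdist⟩ := D.exists_d_zero_le_rpow (C + 1)
    refine ⟨C + M + K * (C + 1) ^ 2, by positivity, fun r hr hr1 x hx => ?_⟩
    obtain ⟨y, hy0, hyd, hyx⟩ := ih r hr hr1 x hx
    have hy : ‖y‖ ≤ (C + 1) * r := by
      refine (pi_norm_le_iff_of_nonneg (by positivity)).2 fun i => ?_
      rcases le_or_gt (G.deg i) j with h | h
      · rw [hy0 i h, norm_zero]
        positivity
      · have hxi : |x i| ≤ r := (norm_le_pi_norm x i).trans hx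
        have hr2 : C * r ^ 2 ≤ C * r := by
          gcongr
          nlinarith
        calc |y i| = |(y i - x i) + x i| := by ring_nf
          _ ≤ |y i - x i| + |x i| := abs_add_le _ _
          _ ≤ (C + 1) * r := by linarith [hyx i h]
    set v : G.Pt := -G.layerProj (j + 1) y with hvdef
    have hv0 : ∀ i, G.deg i ≠ j + 1 → v i = 0 := fun i hi => by
      simp [hvdef, StratifiedGroup.layerProj, hi]
    have hv : ‖v‖ ≤ (C + 1) * r := by
      rw [hvdef, norm_neg]
      exact (StratifiedGroup.norm_layerProj_le _ _).trans hy
    have hball : (C + 1) * r ≤ C + 1 := mul_le_of_le_one_right (by positivity) hr1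
    refine ⟨G.mul y v, fun i hi => ?_, fun k hk hjk => ?_, fun i hi => ?_⟩
    · rw [StratifiedGroup.mul_apply_of_vanish_below
        fun k hk => ⟨hy0 k (by omega), hv0 k (by omega)⟩]
      rcases hi.lt_or_eq with h | h
      · rw [hy0 i (by omega), hv0 i (by omega), add_zero]
      · simp [hvdef, StratifiedGroup.layerProj, h]
    · have hpow : r ^ ((1 : ℝ) / (j + 1 : ℕ)) ≤ r ^ ((1 : ℝ) / k) :=
        Real.rpow_le_rpow_of_exponent_ge hr hr1 (by gcongr)
      calc D.d x (G.mul y v) ≤ D.d x y + D.d y (G.mul y v) := D.triangle _ _ _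
        _ ≤ C * r ^ ((1 : ℝ) / k) + M * r ^ ((1 : ℝ) / k) := by
            rw [D.d_self_mul]
            exact add_le_add (hyd k hk (by omega))
              ((hdist (j + 1) (by omega) r hr v hv0 hv).trans (by gcongr))
        _ ≤ (C + M + K * (C + 1) ^ 2) * r ^ ((1 : ℝ) / k) := by
            have : 0 ≤ K * (C + 1) ^ 2 * r ^ ((1 : ℝ) / k) := by positivity
            linarith
    · have hQ : |G.mul y v i - y i| ≤ K * (C + 1) ^ 2 * r ^ 2 := by
        calc |G.mul y v i - y i| = ‖(G.mul y v - y - v) i‖ := by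
              simp [hv0 i (by omega)]
          _ ≤ ‖G.mul y v - y - v‖ := norm_le_pi_norm _ i
          _ ≤ K * ‖y‖ * ‖v‖ := hmul y v (hy.trans hball) (hv.trans hball)
          _ ≤ K * ((C + 1) * r) * ((C + 1) * r) := by gcongr
          _ = K * (C + 1) ^ 2 * r ^ 2 := by ring
      have hM2 : 0 ≤ M * r ^ 2 := by positivity
      linarith [abs_sub_le (G.mul y v i) (y i) (x i), hyx i (by omega)]

end HomDistOn

/-- **Lemma 2.2 (approximation killing the first `j` layers).**
Let `G` be a stratified group with homogeneous distance `d`, in adapted exponential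
coordinates with layer components `x = (x¹, …, x^ι)`.  There is a constant `C = C(d) > 0`
such that for every `0 < r ≤ 1`, every `x ∈ B_E(0,r)` and every `j ∈ {1, …, ι}` there is
`x̃ ∈ G` with `x̃¹ = ⋯ = x̃ʲ = 0`, `d(x, x̃) ≤ C r^{1/j}` and `|x̃ʰ - xʰ| ≤ C r²` for all
`h = j+1, …, ι`. -/
theorem statement8 (G : StratifiedGroup) (D : HomDistOn G) :
    ∃ C : ℝ, 0 < C ∧ ∀ r : ℝ, 0 < r → r ≤ 1 → ∀ x : G.Pt, x ∈ eBall 0 r →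
      ∀ j : ℕ, 1 ≤ j → j ≤ G.ι →
        ∃ xt : G.Pt, (∀ i, G.deg i ≤ j → xt i = 0) ∧
          D.d x xt ≤ C * r ^ ((1 : ℝ) / (j : ℝ)) ∧
          ∀ h : ℕ, j < h → h ≤ G.ι → eNorm (G.layerProj h (xt - x)) ≤ C * r ^ 2 := by
  choose C hC h using D.exists_vanish_first_layers
  set S : ℝ := ∑ j ∈ Finset.range (G.ι + 1), C j with hS
  have hS0 : 0 ≤ S := Finset.sum_nonneg fun j _ => hC j
  have hSn : S ≤ (G.n + 1) * S + 1 := by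
    have : 0 ≤ (G.n : ℝ) * S := by positivity
    linarith
  refine ⟨(G.n + 1) * S + 1, by positivity, fun r hr hr1 x hx j hj hjι => ?_⟩
  have hCS : C j ≤ S :=
    Finset.single_le_sum (fun j _ => hC j) (Finset.mem_range.2 (by omega))
  have hxr : ‖x‖ ≤ r := by
    have hx' : eNorm (x - 0) < r := hx
    rw [sub_zero] at hx'
    exact (norm_le_eNorm x).trans hx'.le
  obtain ⟨xt, h0, hd, hxt⟩ := h j r hr hr1 x hxr
  refine ⟨xt, h0, (hd j hj le_rfl).trans ?_, fun k hk _ => ?_⟩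
  · gcongr
    exact hCS.trans hSn
  · have hSr : 0 ≤ S * r ^ 2 := by positivity
    have hlayer : eNorm (G.layerProj k (xt - x)) ≤ (G.n + 1) * (S * r ^ 2) := by
      refine eNorm_le_of_forall_abs_le hSr fun i => ?_
      by_cases hi : G.deg i = k
      · simp only [StratifiedGroup.layerProj, hi, if_true, Pi.sub_apply]
        exact (hxt i (by omega)).trans (by gcongr)
      · simpa [StratifiedGroup.layerProj, hi] using hSr
    nlinarith [sq_nonneg r]
end

section
/- Let ℍ^n be the Heisenberg group with a homogeneous distance d, let λ ∈ (0,1], and let Σ ⊂ ℍ^n be a submanifold of class C^{1,λ} with generalized characteristic set Σ_c. If Σ has dimension p with 2 ≤ p ≤ 2n, then dim_H Σ_c ≤ p + 1 − λ; if Σ is a curve (p = 1), then dim_H Σ_c ≤ 2/(1+λ) ≤ 2 − λ, where dim_H is the Hausdorff dimension with respect to d. -/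
open Set Filter Function Module MeasureTheory
open scoped ENNReal Topology NNReal

section QuadraticForms

variable {E : Type*} [NormedAddCommGroup E] [NormedSpace ℝ E]

/-- A map which is positively homogeneous of degree one and differentiable at the origin
coincides with its differential there. -/
lemma HasFDerivAt.eq_of_homogeneous {F : Type*} [NormedAddCommGroup F] [NormedSpace ℝ F]
    {g : E → F} {L : E →L[ℝ] F} (hL : HasFDerivAt g L 0) (h0 : g 0 = 0)
    (hg : ∀ r : ℝ, 0 < r → ∀ q, g (r • q) = r • g q) (q : E) : g q = L q := by
  have hlin : HasDerivAt (fun t : ℝ => t • q) q 0 := by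
    simpa using (hasDerivAt_id (0 : ℝ)).smul_const q
  have h1 : HasDerivAt (fun t : ℝ => g (t • q)) (L q) 0 :=
    HasFDerivAt.comp_hasDerivAt (f := fun t : ℝ => t • q) (0 : ℝ) (by simpa using hL) hlin
  have h2 : HasDerivWithinAt (fun t : ℝ => g (t • q)) (g q) (Ici 0) 0 := by
    have h3 : HasDerivAt (fun t : ℝ => t • g q) (g q) 0 := by
      simpa using (hasDerivAt_id (0 : ℝ)).smul_const (g q)
    refine h3.hasDerivWithinAt.congr (fun t ht => ?_) (by simp [h0])
    rcases eq_or_lt_of_le (mem_Ici.1 ht) with rfl | ht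
    · simp [h0]
    · exact hg t ht q
  exact (uniqueDiffOn_Ici (0 : ℝ) 0 self_mem_Ici).eq_deriv _ h2 h1.hasDerivWithinAt

/-- A `C²` function which is positively homogeneous of degree two is a quadratic form. -/
lemma exists_quadratic_of_homogeneous {f : E → ℝ} (hf : ContDiff ℝ 2 f)
    (hom : ∀ r : ℝ, 0 < r → ∀ q, f (r • q) = r ^ 2 * f q) :
    ∃ L : E →L[ℝ] E →L[ℝ] ℝ, ∀ q, f q = L q q := by
  have hd : Differentiable ℝ f := hf.differentiable (by norm_num)
  have hd' : ContDiff ℝ 1 (fderiv ℝ f) := hf.fderiv_right (by norm_num)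
  have hhom : ∀ r : ℝ, 0 < r → ∀ q, fderiv ℝ f (r • q) = r • fderiv ℝ f q := by
    intro r hr q
    have h1 : fderiv ℝ (fun x => f (r • x)) q = r • fderiv ℝ f (r • q) := fderiv_comp_smul r
    have h2 : fderiv ℝ (fun x => f (r • x)) q = r ^ 2 • fderiv ℝ f q := by
      have : (fun x => f (r • x)) = fun x => r ^ 2 • f x := by
        funext x; simpa using hom r hr x
      rw [this, fderiv_fun_const_smul (hd q)]
    have h3 : r • fderiv ℝ f (r • q) = r • (r • fderiv ℝ f q) := by
      rw [← h1, h2, smul_smul, sq]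
    exact smul_right_injective _ hr.ne' h3
  have hzero : fderiv ℝ f 0 = 0 := by
    have := hhom 2 two_pos 0
    rw [smul_zero, two_smul] at this
    simpa using this
  have hL : HasFDerivAt (fderiv ℝ f) (fderiv ℝ (fderiv ℝ f) 0) 0 :=
    ((hd'.differentiable (by norm_num)) 0).hasFDerivAt
  refine ⟨(1 / 2 : ℝ) • fderiv ℝ (fderiv ℝ f) 0, fun q => ?_⟩
  have hlin : HasDerivAt (fun t : ℝ => t • q) q 1 := by
    simpa using (hasDerivAt_id (1 : ℝ)).smul_const q
  have h1 : HasDerivAt (fun t : ℝ => f (t • q)) (fderiv ℝ f q q) 1 :=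
    HasFDerivAt.comp_hasDerivAt (f := fun t : ℝ => t • q) (1 : ℝ)
      (by simpa using (hd q).hasFDerivAt) hlin
  have h2 : HasDerivAt (fun t : ℝ => f (t • q)) (2 * f q) 1 := by
    have h3 : HasDerivAt (fun t : ℝ => t ^ 2 * f q) (2 * f q) 1 := by
      simpa using (hasDerivAt_pow 2 (1 : ℝ)).mul_const (f q)
    refine h3.congr_of_eventuallyEq ?_
    filter_upwards [lt_mem_nhds (zero_lt_one' ℝ)] with t ht using hom t ht q
  have h3 := h1.unique h2
  rw [hL.eq_of_homogeneous hzero hhom q] at h3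
  simp only [_root_.smul_apply, smul_eq_mul]
  linarith

/-- A `C²` function on a product which is positively homogeneous of degree two and vanishes on
both axes is bilinear. -/
lemma exists_bilinear_of_homogeneous {f : E × E → ℝ} (hf : ContDiff ℝ 2 f)
    (hom : ∀ r : ℝ, 0 < r → ∀ q, f (r • q) = r ^ 2 * f q)
    (hleft : ∀ x, f (x, 0) = 0) (hright : ∀ y, f (0, y) = 0) :
    ∃ B : E →L[ℝ] E →L[ℝ] ℝ, ∀ x y, f (x, y) = B x y := by
  obtain ⟨L, hL⟩ := exists_quadratic_of_homogeneous hf hom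
  let i₁ := ContinuousLinearMap.inl ℝ E E
  let i₂ := ContinuousLinearMap.inr ℝ E E
  refine ⟨L.bilinearComp i₁ i₂ + L.flip.bilinearComp i₁ i₂, fun x y => ?_⟩
  have hx := hL (x, 0)
  have hy := hL (0, y)
  rw [hleft] at hx
  rw [hright] at hy
  have hxy : ((x, y) : E × E) = (x, 0) + (0, y) := by simp
  rw [hL, hxy]
  simp only [map_add, _root_.add_apply, ContinuousLinearMap.bilinearComp_apply,
    ContinuousLinearMap.flip_apply, i₁, i₂, ContinuousLinearMap.inl_apply,
    ContinuousLinearMap.inr_apply]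
  linarith

end QuadraticForms

section TangentCone

/-- The tangent cone of a set locally parametrized by an immersion is contained in the range of
the differential of the immersion. -/
lemma tangentConeAt_subset_range {P E : Type*} [NormedAddCommGroup P] [NormedSpace ℝ P]
    [FiniteDimensional ℝ P] [NormedAddCommGroup E] [NormedSpace ℝ E] [FiniteDimensional ℝ E]
    {ψ : P → E} {A : P →L[ℝ] E} {t : P} {R : Set E} (hψ : HasFDerivAt ψ A t)
    (hA : Injective A) (hR : ∀ W ∈ 𝓝 t, ∀ᶠ y in 𝓝[R] (ψ t), y ∈ ψ '' W) :
    tangentConeAt ℝ R (ψ t) ⊆ LinearMap.range A.toLinearMap := by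
  obtain ⟨Q, hQ⟩ := (LinearMap.range A.toLinearMap).exists_isCompl
  let π := (Submodule.projectionOnto Q _ hQ.symm).toContinuousLinearMap
  have hπ : ∀ w, π w = 0 ↔ w ∈ LinearMap.range A.toLinearMap := fun w =>
    Submodule.projectionOnto_apply_eq_zero_iff hQ.symm
  have hπA : ∀ s, π (A s) = 0 := fun s => (hπ _).2 ⟨s, rfl⟩
  obtain ⟨K, hK, hanti⟩ := A.toLinearMap.exists_antilipschitzWith (LinearMap.ker_eq_bot.2 hA)
  have hlow : ∀ s, ‖s‖ ≤ K * ‖A s‖ := fun s => by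
    simpa [dist_eq_norm] using hanti.le_mul_dist s 0
  have hK' : (0 : ℝ) < K := hK
  have hzero : HasFDerivWithinAt π (0 : E →L[ℝ] Q) R (ψ t) := by
    refine HasFDerivWithinAt.of_isLittleO (Asymptotics.isLittleO_iff.2 fun c hc => ?_)
    set ε : ℝ := min (1 / (2 * K)) (c / (2 * K * (‖π‖ + 1))) with hε
    have hε0 : 0 < ε := by positivity
    have hε1 : ε * (2 * K) ≤ 1 := by
      have : ε ≤ 1 / (2 * K) := min_le_left _ _
      rwa [le_div_iff₀ (by positivity)] at this
    have hε2 : ε * (2 * K * (‖π‖ + 1)) ≤ c := by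
      have : ε ≤ c / (2 * K * (‖π‖ + 1)) := min_le_right _ _
      rwa [le_div_iff₀ (by positivity)] at this
    have hW := (Asymptotics.isLittleO_iff.1 hψ.isLittleO) hε0
    filter_upwards [hR _ hW] with y hy
    obtain ⟨s, hs, rfl⟩ := hy
    replace hs : ‖ψ s - ψ t - A (s - t)‖ ≤ ε * ‖s - t‖ := hs
    have h1 : ‖A (s - t)‖ ≤ ‖ψ s - ψ t‖ + ε * ‖s - t‖ := by
      calc ‖A (s - t)‖ = ‖(ψ s - ψ t) - (ψ s - ψ t - A (s - t))‖ := by congr 1; abel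
        _ ≤ ‖ψ s - ψ t‖ + ‖ψ s - ψ t - A (s - t)‖ := norm_sub_le _ _
        _ ≤ _ := by gcongr
    have h2 : ‖s - t‖ ≤ 2 * K * ‖ψ s - ψ t‖ := by
      have := hlow (s - t)
      have h3 : (K : ℝ) * ‖A (s - t)‖ ≤ K * (‖ψ s - ψ t‖ + ε * ‖s - t‖) := by gcongr
      have h4 : (ε * (2 * K)) * ‖s - t‖ ≤ 1 * ‖s - t‖ := by gcongr
      nlinarith
    have h3 : π (ψ s) - π (ψ t) = π (ψ s - ψ t - A (s - t)) := by
      simp only [map_sub, hπA, sub_zero]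
    simp only [_root_.zero_apply, sub_zero, h3]
    calc ‖π (ψ s - ψ t - A (s - t))‖ ≤ ‖π‖ * (ε * (2 * K * ‖ψ s - ψ t‖)) :=
          (π.le_opNorm _).trans (by gcongr; exact hs.trans (by gcongr))
      _ ≤ (‖π‖ + 1) * (ε * (2 * K * ‖ψ s - ψ t‖)) := by gcongr; linarith
      _ = ε * (2 * K * (‖π‖ + 1)) * ‖ψ s - ψ t‖ := by ring
      _ ≤ c * ‖ψ s - ψ t‖ := by gcongr
  intro w hw
  have h := (π.hasFDerivAt.hasFDerivWithinAt (s := R)).unique_on hzero hw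
  exact (hπ w).1 (by simpa using h)

/-- A subspace of `ℝⁿ` on which the coordinate `l` does not vanish is mapped injectively by the
projection onto a set of `dim T` coordinates containing `l`. -/
lemma exists_coords_injective {n : ℕ} (T : Submodule ℝ (Fin n → ℝ)) (l : Fin n)
    (hl : ∃ v ∈ T, v l ≠ 0) :
    ∃ α : Finset (Fin n), α.card = finrank ℝ T ∧ l ∈ α ∧
      ∀ v ∈ T, (∀ i ∈ α, v i = 0) → v = 0 := by
  classical
  let e : Fin n → Module.Dual ℝ T := fun i => (LinearMap.proj i).comp T.subtype
  have he : ∀ i (v : T), e i v = (v : Fin n → ℝ) i := fun _ _ => rfl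
  have hind : LinearIndepOn ℝ e {l} := by
    obtain ⟨v, hv, hvl⟩ := hl
    refine LinearIndepOn.singleton fun h => hvl ?_
    exact (he l ⟨v, hv⟩).symm.trans (by rw [h, LinearMap.zero_apply])
  obtain ⟨b, -, hlb, hspan, hb⟩ := exists_linearIndepOn_extension hind (subset_univ {l})
  have hinj : ∀ v ∈ T, (∀ i ∈ b.toFinset, v i = 0) → v = 0 := by
    intro v hv h
    have hle : Submodule.span ℝ (e '' b) ≤ LinearMap.ker (Module.Dual.eval ℝ T ⟨v, hv⟩) := by
      rw [Submodule.span_le]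
      rintro _ ⟨i, hi, rfl⟩
      exact h i (mem_toFinset.2 hi)
    funext i
    exact hle (hspan ⟨i, mem_univ i, rfl⟩)
  refine ⟨b.toFinset, le_antisymm ?_ ?_, mem_toFinset.2 (hlb rfl), hinj⟩
  · have := hb.fintype_card_le_finrank
    rwa [Subspace.dual_finrank_eq, ← toFinset_card] at this
  · let ρ : T →ₗ[ℝ] (b.toFinset → ℝ) := LinearMap.pi fun i => e i
    have hρ : Injective ρ := by
      rw [← LinearMap.ker_eq_bot, LinearMap.ker_eq_bot']
      rintro ⟨v, hv⟩ h
      exact Subtype.ext (hinj v hv fun i hi => congrFun h ⟨i, hi⟩)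
    simpa using LinearMap.finrank_le_finrank_of_injective hρ

end TangentCone

/-- The group law of `G` is `x + y + B(x, y) e_l` for an alternating bilinear form `B`, where `l` is
the only coordinate of degree two and all the others have degree one. -/
structure IsCenterForm (G : StratifiedGroup) (l : Fin G.n) (B : G.Pt →L[ℝ] G.Pt →L[ℝ] ℝ) :
    Prop where
  deg_center : G.deg l = 2
  deg_of_ne : ∀ i, i ≠ l → G.deg i = 1
  self_eq_zero : ∀ x, B x x = 0
  center_eq_zero : ∀ x, B x (Pi.single l 1) = 0
  mul_eq : ∀ x y, G.mul x y = x + y + B x y • Pi.single l 1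

lemma IsHeisenberg.exists_isCenterForm {G : StratifiedGroup} {n : ℕ} (hH : IsHeisenberg G n) :
    ∃ l B, IsCenterForm G l B := by
  obtain ⟨hι, -, -, h2, -⟩ := hH
  obtain ⟨l, hl⟩ := Finset.card_eq_one.1 h2
  have hmem : ∀ i, G.deg i = 2 ↔ i = l := fun i => by
    simpa using Finset.ext_iff.1 hl i
  have hdl : G.deg l = 2 := (hmem l).2 rfl
  have hne : ∀ i, i ≠ l → G.deg i = 1 := fun i hi => by
    have h1 := G.deg_pos i
    have h3 := G.deg_le i
    have h4 : G.deg i ≠ 2 := fun h => hi ((hmem i).1 h)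
    omega
  have hmul1 : ∀ x y i, i ≠ l → G.mul x y i = x i + y i := fun x y i hi => by
    have h := G.mul_graded x 0 y 0 i fun k hk => by
      have := G.deg_pos k
      have := hne i hi
      omega
    rw [G.mul_zero'] at h
    simp only [Pi.zero_apply, sub_self] at h
    linarith
  let f : G.Pt × G.Pt → ℝ := fun q => G.mul q.1 q.2 l - q.1 l - q.2 l
  have hf : ContDiff ℝ 2 f := by
    have h := contDiff_pi.1 (G.mul_smooth.of_le (m := 2) le_top) l
    have h1 : ContDiff ℝ 2 fun q : G.Pt × G.Pt => q.1 l := by fun_prop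
    have h2 : ContDiff ℝ 2 fun q : G.Pt × G.Pt => q.2 l := by fun_prop
    exact (h.sub h1).sub h2
  have hom : ∀ r : ℝ, 0 < r → ∀ q, f (r • q) = r ^ 2 * f q := by
    rintro r hr ⟨x, y⟩
    have h1 := G.mul_graded (r • x) (fun k => r ^ G.deg k * x k) (r • y)
      (fun k => r ^ G.deg k * y k) l fun k hk => by
        have hk' : k ≠ l := by rintro rfl; exact lt_irrefl _ hk
        simp [hne k hk']
    have h2 := G.dil_mul r hr x y l
    rw [h2, hdl] at h1
    simp only [f, Prod.smul_mk]
    rw [h1]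
    ring
  obtain ⟨B, hB⟩ := exists_bilinear_of_homogeneous hf hom
    (fun x => by simp [f, G.mul_zero']) (fun y => by simp [f, G.zero_mul'])
  have hmul : ∀ x y, G.mul x y = x + y + B x y • Pi.single l 1 := fun x y => by
    funext i
    by_cases hi : i = l
    · subst hi
      simp [← hB, f]
    · simp [hi, hmul1 x y i hi]
  refine ⟨l, B, hdl, hne, fun x => ?_, fun x => ?_, hmul⟩
  · have h := congrFun (hmul x (-x)) l
    simpa [G.mul_neg'] using h
  · have h := G.mul_graded x x (Pi.single l 1) 0 l fun k hk => by
      have hk' : k ≠ l := by rintro rfl; exact lt_irrefl _ hk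
      simp [hk']
    simp only [hmul, Pi.add_apply, Pi.smul_apply, Pi.single_eq_same, Pi.zero_apply, map_zero,
      smul_eq_mul] at h
    linarith

namespace IsCenterForm

variable {G : StratifiedGroup} {l : Fin G.n} {B : G.Pt →L[ℝ] G.Pt →L[ℝ] ℝ}

lemma neg_mul (h : IsCenterForm G l B) (x y : G.Pt) :
    G.mul (-x) y = (y - x) - B x (y - x) • Pi.single l 1 := by
  rw [h.mul_eq, map_neg, map_sub, h.self_eq_zero, sub_zero, _root_.neg_apply, neg_smul]
  abel

lemma exists_dist_le (h : IsCenterForm G l B) (D : HomDistOn G) :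
    ∃ C : ℝ, 0 < C ∧ ∀ r : ℝ, 0 < r → ∀ x y : G.Pt, ‖y - x‖ ≤ r →
      |(y - x) l - B x (y - x)| ≤ r ^ 2 → D.d x y ≤ C * r := by
  have hcont : Continuous fun w : G.Pt => D.d 0 w :=
    D.continuous.comp (Continuous.prodMk_right 0)
  obtain ⟨C, hC⟩ := (isCompact_closedBall (0 : G.Pt) 1).bddAbove_image hcont.continuousOn
  have hC' : ∀ w : G.Pt, ‖w‖ ≤ 1 → D.d 0 w ≤ max C 1 := fun w hw =>
    (hC ⟨w, by simpa using hw, rfl⟩).trans (le_max_left _ _)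
  refine ⟨max C 1, by positivity, fun r hr x y hxy hV => ?_⟩
  have h0 : G.mul (-x) x = 0 := by simpa using G.mul_neg' (-x)
  rw [← D.left_invariant x y (-x), h0]
  set w := G.mul (-x) y with hw
  have hwi : ∀ i, |w i| ≤ r ^ G.deg i := fun i => by
    rw [hw, h.neg_mul]
    by_cases hi : i = l
    · subst hi
      simpa [h.deg_center] using hV
    · have := (norm_le_pi_norm (y - x) i).trans hxy
      simpa [hi, h.deg_of_ne i hi] using this
  have hdil : w = G.dil r (G.dil r⁻¹ w) := by
    funext i
    simp [StratifiedGroup.dil, hr.ne']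
  have hdil0 : (0 : G.Pt) = G.dil r 0 := by
    funext i
    simp [StratifiedGroup.dil]
  rw [hdil, hdil0, D.homogeneous r hr, mul_comm]
  refine mul_le_mul_of_nonneg_right (hC' _ ((pi_norm_le_iff_of_nonneg zero_le_one).2 fun i => ?_))
    hr.le
  have hp : 0 < r ^ G.deg i := by positivity
  rw [StratifiedGroup.dil, Real.norm_eq_abs, abs_mul, inv_pow, abs_of_pos (inv_pos.2 hp),
    inv_mul_le_iff₀ hp, mul_one]
  exact hwi i

lemma sum_deg (h : IsCenterForm G l B) (α : Finset (Fin G.n)) :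
    ∑ i ∈ α, G.deg i = α.card + if l ∈ α then 1 else 0 := by
  have hdeg : ∀ i, G.deg i = 1 + if i = l then 1 else 0 := fun i => by
    by_cases hi : i = l
    · simp [hi, h.deg_center]
    · simp [hi, h.deg_of_ne i hi]
  simp [hdeg, Finset.sum_add_distrib]

/-- At a generalized characteristic point the tangent space is horizontal. -/
lemma horizontal_of_mem_charSet (h : IsCenterForm G l B) {p : ℕ} {S : Set G.Pt}
    {V : Set (Fin p → ℝ)} {φ : (Fin p → ℝ) → G.Pt} (hφ : IsC1Chart G.n p S V φ)
    {t : Fin p → ℝ} (ht : t ∈ V) (hc : φ t ∈ G.charSet p S) (v : Fin p → ℝ) :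
    fderivWithin ℝ φ V t v l - B (φ t) (fderivWithin ℝ φ V t v) = 0 := by
  obtain ⟨hV, hC1, -, hinj, hopen⟩ := hφ
  set x := φ t with hx
  set A := fderivWithin ℝ φ V t with hA
  let M : G.Pt →L[ℝ] G.Pt := ContinuousLinearMap.id ℝ _ - (B x).smulRight (Pi.single l 1)
  have hM : ∀ u, M u = u - B x u • Pi.single l 1 := fun u => rfl
  have hMl : ∀ u, M u l = u l - B x u := fun u => by simp [hM]
  have hMinj : Injective M := by
    rw [← ContinuousLinearMap.coe_coe, ← LinearMap.ker_eq_bot, LinearMap.ker_eq_bot']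
    intro u hu
    have hu' : u = B x u • Pi.single l 1 := sub_eq_zero.1 hu
    have hBu : B x u = 0 := by
      rw [hu', map_smul, h.center_eq_zero, smul_zero]
    rw [hu', hBu, zero_smul]
  let ψ : (Fin p → ℝ) → G.Pt := fun s => M (φ s - x)
  have hψmul : ∀ s, ψ s = G.mul (-x) (φ s) := fun s => (h.neg_mul x (φ s)).symm
  have hψt : ψ t = 0 := by simp [ψ, hx]
  have hφt : HasFDerivAt φ A t :=
    ((hC1.differentiableOn one_ne_zero t ht).hasFDerivWithinAt).hasFDerivAt (hV.mem_nhds ht)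
  have hψ : HasFDerivAt ψ (M.comp A) t := M.hasFDerivAt.comp t (hφt.sub_const x)
  have hMA : Injective (M.comp A) := hMinj.comp (hinj t ht)
  have hφS : φ '' V ⊆ S := by
    obtain ⟨O, -, hO⟩ := hopen V Subset.rfl hV
    exact hO ▸ inter_subset_left
  have hR : ∀ W ∈ 𝓝 t, ∀ᶠ y in 𝓝[G.shift x S] (ψ t), y ∈ ψ '' W := by
    intro W hW
    obtain ⟨O, hOo, hO⟩ := hopen (interior W ∩ V) inter_subset_right
      (isOpen_interior.inter hV)
    have hxO : x ∈ O :=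
      (hO ▸ mem_image_of_mem φ ⟨mem_interior_iff_mem_nhds.2 hW, ht⟩ : x ∈ S ∩ O).2
    have hcont : Continuous fun y => G.mul x y := by
      simp only [h.mul_eq]
      fun_prop
    have hnear : ∀ᶠ y in 𝓝 (ψ t), G.mul x y ∈ O := by
      refine hcont.continuousAt.eventually_mem (hOo.mem_nhds ?_)
      rwa [hψt, G.mul_zero']
    filter_upwards [nhdsWithin_le_nhds hnear, self_mem_nhdsWithin] with y hyO hyR
    obtain ⟨z, hz, rfl⟩ := hyR
    rw [← G.mul_assoc', G.mul_neg', G.zero_mul'] at hyO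
    obtain ⟨s, hs, rfl⟩ : z ∈ φ '' (interior W ∩ V) := hO ▸ ⟨hz, hyO⟩
    exact ⟨s, interior_subset hs.1, hψmul s⟩
  have hrange : G.tangentAt S x = LinearMap.range (M.comp A).toLinearMap := by
    refine le_antisymm (Submodule.span_le.2 ?_) ?_
    · have := tangentConeAt_subset_range hψ hMA hR
      rwa [hψt] at this
    · rintro _ ⟨u, rfl⟩
      refine Submodule.subset_span ?_
      have hu : u ∈ tangentConeAt ℝ V t := by
        rw [tangentConeAt_of_mem_nhds (hV.mem_nhds ht)]
        trivial
      have h1 := (hψ.hasFDerivWithinAt (s := V)).mapsTo_tangent_cone hu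
      rw [hψt] at h1
      refine tangentConeAt_mono ?_ h1
      rintro _ ⟨s, hs, rfl⟩
      exact ⟨φ s, hφS (mem_image_of_mem φ hs), (hψmul s).symm⟩
  rw [← hMl]
  by_contra hne
  obtain ⟨α, hα, hlα, hαinj⟩ := exists_coords_injective (G.tangentAt S x) l
    ⟨M (A v), hrange ▸ ⟨v, rfl⟩, hne⟩
  have hcard : α.card = p := by
    rw [hα, hrange, LinearMap.finrank_range_of_inj hMA, finrank_fin_fun]
  have hle : p + 1 ≤ G.pointDeg p S x := by
    refine le_csSup ⟨∑ i, G.deg i, ?_⟩ ⟨α, hcard, hαinj, ?_⟩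
    · rintro _ ⟨β, -, -, rfl⟩
      exact Finset.sum_le_sum_of_subset (Finset.subset_univ β)
    · rw [h.sum_deg, hcard, if_pos hlα]
  have hmax : G.maxDim p ≤ p + 1 := by
    refine csSup_le' ?_
    rintro _ ⟨β, hβ, rfl⟩
    rw [h.sum_deg, hβ]
    split_ifs <;> omega
  exact absurd hc.2 (not_lt.2 (hmax.trans hle))

end IsCenterForm

section HausdorffContent

variable {α : Type*}

/-- The `q`-dimensional Hausdorff content built from the distance function `dist`. -/
noncomputable def hContent (dist : α → α → ℝ) (q : ℝ) (hq : 0 < q) : OuterMeasure α :=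
  OuterMeasure.ofFunction (fun A => sdiam dist A ^ q) (by simp [sdiam, hq])

lemma hMeas_eq_zero_of_hContent {dist : α → α → ℝ} {q : ℝ} (hq : 0 < q) {A : Set α}
    (hA : hContent dist q hq A = 0) : hMeas dist q A = 0 := by
  simp only [hMeas, ENNReal.iSup_eq_zero]
  intro δ hδ
  refine le_antisymm (le_of_forall_gt fun η hη => ?_) zero_le
  have hpos : 0 < min η (δ ^ q) := lt_min hη (ENNReal.rpow_pos_of_nonneg hδ hq.le)
  rw [← hA, hContent, OuterMeasure.ofFunction_apply] at hpos
  obtain ⟨t, ht⟩ := iInf_lt_iff.1 hpos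
  obtain ⟨hcov, hsum⟩ := iInf_lt_iff.1 ht
  refine lt_of_le_of_lt (iInf₂_le_of_le t hcov (iInf_le _ fun i => ?_))
    (hsum.trans_le (min_le_left _ _))
  exact (ENNReal.rpow_le_rpow_iff hq).1
    ((ENNReal.le_tsum i).trans (hsum.le.trans (min_le_right _ _)))

lemma hDim_le_of_hContent {dist : α → α → ℝ} {q : ℝ} (hq : 0 ≤ q) {A : Set α}
    (hA : ∀ q' (hq' : 0 < q'), q < q' → hContent dist q' hq' A = 0) :
    hDim dist A ≤ ENNReal.ofReal q := by
  refine le_of_forall_gt fun b hb => ?_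
  obtain ⟨r, hr0, hr, hrb⟩ := ENNReal.lt_iff_exists_real_btwn.1 hb
  have hqr : q < r := (ENNReal.ofReal_lt_ofReal_iff_of_nonneg hq).1 hr
  have hr' : 0 < r := hq.trans_lt hqr
  exact lt_of_le_of_lt (sInf_le ⟨r, hr0, rfl, hMeas_eq_zero_of_hContent hr' (hA r hr' hqr)⟩) hrb

lemma hContent_image_le {β : Type*} {dist : α → α → ℝ} {q : ℝ} (hq : 0 < q) {φ : β → α}
    {U : Set β} {a : ℝ} (ha : 0 ≤ a) (hU : ∀ s ∈ U, ∀ s' ∈ U, dist (φ s) (φ s') ≤ a) :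
    hContent dist q hq (φ '' U) ≤ ENNReal.ofReal (a ^ q) := by
  refine (OuterMeasure.ofFunction_le _).trans ?_
  rw [← ENNReal.ofReal_rpow_of_nonneg ha hq.le]
  refine ENNReal.rpow_le_rpow (iSup₂_le fun x hx => iSup₂_le fun y hy => ?_) hq.le
  obtain ⟨s, hs, rfl⟩ := hx
  obtain ⟨s', hs', rfl⟩ := hy
  exact ENNReal.ofReal_le_ofReal (hU s hs s' hs')

/-- Subdivision of a set into pieces on which the vector-valued function `f` oscillates by at
most `ε`. -/
lemma OuterMeasure.le_of_small_oscillation (μ : OuterMeasure α) {p : ℕ} {U : Set α}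
    {f : α → Fin p → ℝ} {c : Fin p → ℝ} {ρ ε : ℝ} (hε : 0 < ε) (hρ : 0 ≤ ρ)
    (hf : ∀ x ∈ U, ‖f x - c‖ ≤ ρ) {β : ℝ≥0∞}
    (hβ : ∀ U' ⊆ U, (∀ x ∈ U', ∀ y ∈ U', ‖f x - f y‖ ≤ ε) → μ U' ≤ β) :
    μ U ≤ ENNReal.ofReal ((2 * ρ / ε + 1) ^ p) * β := by
  classical
  set m := ⌊2 * ρ / ε⌋₊ with hm
  let idx : α → Fin p → ℕ := fun x i => ⌊(f x i - c i + ρ) / ε⌋₊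
  let F : Finset (Fin p → ℕ) := Fintype.piFinset fun _ => Finset.range (m + 1)
  have hcoord : ∀ x ∈ U, ∀ i, |f x i - c i| ≤ ρ := fun x hx i =>
    (norm_le_pi_norm (f x - c) i).trans (hf x hx)
  have hF : ∀ x ∈ U, idx x ∈ F := fun x hx => by
    refine Fintype.mem_piFinset.2 fun i => Finset.mem_range.2 (Nat.lt_succ_of_le ?_)
    refine Nat.floor_le_floor ?_
    gcongr
    linarith [(abs_le.1 (hcoord x hx i)).2]
  have hcov : U ⊆ ⋃ k ∈ F, {x ∈ U | idx x = k} := fun x hx =>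
    mem_iUnion₂.2 ⟨idx x, hF x hx, hx, rfl⟩
  have hpiece : ∀ k ∈ F, μ {x ∈ U | idx x = k} ≤ β := fun k _ => by
    refine hβ _ (sep_subset _ _) ?_
    rintro x ⟨hx, rfl⟩ y ⟨hy, hxy⟩
    refine (pi_norm_le_iff_of_nonneg hε.le).2 fun i => ?_
    have hx0 : 0 ≤ (f x i - c i + ρ) / ε :=
      div_nonneg (by linarith [(abs_le.1 (hcoord x hx i)).1]) hε.le
    have hy0 : 0 ≤ (f y i - c i + ρ) / ε :=
      div_nonneg (by linarith [(abs_le.1 (hcoord y hy i)).1]) hε.le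
    have hi : ⌊(f y i - c i + ρ) / ε⌋₊ = ⌊(f x i - c i + ρ) / ε⌋₊ := congrFun hxy i
    have h1 := Nat.floor_le hx0
    have h2 := Nat.lt_floor_add_one ((f x i - c i + ρ) / ε)
    have h3 := Nat.floor_le hy0
    have h4 := Nat.lt_floor_add_one ((f y i - c i + ρ) / ε)
    rw [hi] at h3 h4
    have h5 : (f x i - f y i) / ε = (f x i - c i + ρ) / ε - (f y i - c i + ρ) / ε := by ring
    have h6 : |(f x i - f y i) / ε| ≤ 1 := by
      rw [h5, abs_le]
      constructor <;> linarith
    rwa [abs_div, abs_of_pos hε, div_le_one hε] at h6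
  have hcard : (F.card : ℝ≥0∞) ≤ ENNReal.ofReal ((2 * ρ / ε + 1) ^ p) := by
    have h1 : F.card = (m + 1) ^ p := by simp [F]
    have h2 : (m : ℝ) ≤ 2 * ρ / ε := Nat.floor_le (by positivity)
    rw [h1, ← ENNReal.ofReal_natCast]
    refine ENNReal.ofReal_le_ofReal ?_
    push_cast
    gcongr
  calc μ U ≤ μ (⋃ k ∈ F, {x ∈ U | idx x = k}) := measure_mono hcov
    _ ≤ ∑ k ∈ F, μ {x ∈ U | idx x = k} := measure_biUnion_finset_le _ _
    _ ≤ F.card • β := Finset.sum_le_card_nsmul _ _ _ hpiece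
    _ = F.card * β := nsmul_eq_mul _ _
    _ ≤ _ := by gcongr

lemma ENNReal.eq_zero_of_le_rpow {m : ℝ≥0∞} {C e : ℝ} (he : 0 < e)
    (h : ∀ r : ℝ, 0 < r → r ≤ 1 → m ≤ ENNReal.ofReal (C * r ^ e)) : m = 0 := by
  have hcont : ContinuousAt (fun r : ℝ => ENNReal.ofReal (C * r ^ e)) 0 :=
    ENNReal.continuous_ofReal.continuousAt.comp
      (continuousAt_const.mul (Real.continuousAt_rpow_const 0 e (Or.inr he.le)))
  have hlim := hcont.tendsto.mono_left (nhdsWithin_le_nhds (s := Ioi 0))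
  simp only [Real.zero_rpow he.ne', mul_zero, ENNReal.ofReal_zero] at hlim
  refine le_antisymm (ge_of_tendsto hlim ?_) zero_le
  filter_upwards [Ioc_mem_nhdsGT zero_lt_one] with r hr using h r hr.1 hr.2

end HausdorffContent

lemma div_add_one_pow_le (p : ℕ) {ρ r : ℝ} (hρ : 0 ≤ ρ) (hr : 0 < r) (hr1 : r ≤ 1) :
    (2 * ρ / r + 1) ^ p ≤ (2 * ρ + 1) ^ p * (r ^ p)⁻¹ := by
  rw [← inv_pow, ← mul_pow]
  gcongr
  rw [add_mul, one_mul, ← div_eq_mul_inv]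
  gcongr
  exact (one_le_inv₀ hr).2 hr1

lemma IsHolderChart.exists_bounds {n p : ℕ} {la : ℝ} {S : Set (Fin n → ℝ)} {V : Set (Fin p → ℝ)}
    {φ : (Fin p → ℝ) → Fin n → ℝ} (hφ : IsHolderChart n p la S V φ) (hla : 0 ≤ la)
    {t : Fin p → ℝ} {ρ : ℝ} (hK : Metric.closedBall t ρ ⊆ V) :
    ∃ L H : ℝ, 1 ≤ L ∧ 0 ≤ H ∧ ∀ s ∈ Metric.closedBall t ρ, ∀ s' ∈ Metric.closedBall t ρ,
      ‖φ s' - φ s‖ ≤ L * ‖s' - s‖ ∧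
      ‖φ s' - φ s - fderivWithin ℝ φ V s (s' - s)‖ ≤ H * ‖s' - s‖ ^ (1 + la) := by
  obtain ⟨⟨hV, hC1, -, -, -⟩, hhol⟩ := hφ
  have hcpt : IsCompact (Metric.closedBall t ρ) := isCompact_closedBall t ρ
  obtain ⟨C, hC⟩ := hhol _ hcpt hK
  obtain ⟨L, hL⟩ := hcpt.exists_bound_of_continuousOn
    ((hC1.continuousOn_fderivWithin hV.uniqueDiffOn (by norm_num)).mono hK)
  have hderiv : ∀ s ∈ Metric.closedBall t ρ, ∀ X ⊆ Metric.closedBall t ρ,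
      HasFDerivWithinAt φ (fderivWithin ℝ φ V s) X s := fun s hs X hX =>
    (hC1.differentiableOn one_ne_zero s (hK hs)).hasFDerivWithinAt.mono (hX.trans hK)
  refine ⟨max L 1, max C 0, le_max_right _ _, le_max_right _ _, fun s hs s' hs' => ⟨?_, ?_⟩⟩
  · exact (convex_closedBall t ρ).norm_image_sub_le_of_norm_hasFDerivWithin_le
      (fun u hu => hderiv u hu _ Subset.rfl)
      (fun u hu => (hL u hu).trans (le_max_left _ _)) hs hs'
  · have hseg : segment ℝ s s' ⊆ Metric.closedBall t ρ :=
      (convex_closedBall t ρ).segment_subset hs hs'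
    rw [Real.rpow_one_add' (norm_nonneg _) (by linarith), mul_comm ‖s' - s‖, ← mul_assoc]
    refine (convex_segment s s').norm_image_sub_le_of_norm_hasFDerivWithin_le'
      (fun u hu => hderiv u (hseg hu) _ hseg) (fun u hu => ?_)
      (left_mem_segment ℝ s s') (right_mem_segment ℝ s s')
    have hus : ‖u - s‖ ≤ ‖s' - s‖ := norm_sub_le_of_mem_segment hu
    refine (hC u (hseg hu) s hs).trans ?_
    gcongr
    exact le_max_left _ _

namespace IsCenterForm

variable {G : StratifiedGroup} {l : Fin G.n} {B : G.Pt →L[ℝ] G.Pt →L[ℝ] ℝ}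

/-- Near a generalized characteristic point, the submanifold separates from the horizontal plane
at that point with order `1 + λ`. -/
lemma exists_vertical_le (h : IsCenterForm G l B) {p : ℕ} {la : ℝ} {S : Set G.Pt}
    {V : Set (Fin p → ℝ)} {φ : (Fin p → ℝ) → G.Pt} (hφ : IsHolderChart G.n p la S V φ)
    (hla : 0 ≤ la) {t : Fin p → ℝ} {ρ : ℝ} (hK : Metric.closedBall t ρ ⊆ V) :
    ∃ L H : ℝ, 1 ≤ L ∧ 0 ≤ H ∧
      (∀ s ∈ Metric.closedBall t ρ, ∀ s' ∈ Metric.closedBall t ρ,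
        ‖φ s' - φ s‖ ≤ L * ‖s' - s‖) ∧
      ∀ s ∈ Metric.closedBall t ρ, φ s ∈ G.charSet p S → ∀ s' ∈ Metric.closedBall t ρ,
        |(φ s' - φ s) l - B (φ s) (φ s' - φ s)| ≤ H * ‖s' - s‖ ^ (1 + la) := by
  obtain ⟨L, H, hL, hH, hb⟩ := hφ.exists_bounds hla hK
  obtain ⟨R, hR⟩ := (isCompact_closedBall t ρ).exists_bound_of_continuousOn
    (hφ.1.2.1.continuousOn.mono hK)
  refine ⟨L, (1 + ‖B‖ * |R|) * H, hL, by positivity,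
    fun s hs s' hs' => (hb s hs s' hs').1, fun s hs hc s' hs' => ?_⟩
  have hhor := h.horizontal_of_mem_charSet hφ.1 (hK hs) hc (s' - s)
  set w := fderivWithin ℝ φ V s (s' - s) with hw
  have hbd := (hb s hs s' hs').2
  rw [← hw] at hbd
  set u := φ s' - φ s - w with hu
  have hsplit : (φ s' - φ s) l - B (φ s) (φ s' - φ s) = u l - B (φ s) u := by
    have : φ s' - φ s = u + w := by rw [hu]; abel
    rw [this, Pi.add_apply, map_add]
    linarith
  have h1 : ‖B (φ s) u‖ ≤ ‖B‖ * |R| * ‖u‖ := by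
    refine (B.le_opNorm₂ _ _).trans ?_
    gcongr
    exact (hR s hs).trans (le_abs_self R)
  calc |(φ s' - φ s) l - B (φ s) (φ s' - φ s)| = ‖u l - B (φ s) u‖ := by
        rw [hsplit, Real.norm_eq_abs]
    _ ≤ ‖u l‖ + ‖B (φ s) u‖ := norm_sub_le _ _
    _ ≤ ‖u‖ + ‖B‖ * |R| * ‖u‖ := add_le_add (norm_le_pi_norm u l) h1
    _ = (1 + ‖B‖ * |R|) * ‖u‖ := by ring
    _ ≤ (1 + ‖B‖ * |R|) * (H * ‖s' - s‖ ^ (1 + la)) := by gcongr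
    _ = _ := by ring

lemma vertical_sub_eq (h : IsCenterForm G l B) (x y y' : G.Pt) :
    (y' - y) l - B y (y' - y) =
      ((y' - x) l - B x (y' - x)) - ((y - x) l - B x (y - x)) - B (y - x) (y' - y) := by
  simp only [map_sub, Pi.sub_apply, _root_.sub_apply, h.self_eq_zero]
  ring

/-- Nullity in every dimension above `2p/(1+λ)`, by covering the characteristic set with images of
small pieces of the parameter domain. -/
lemma hContent_eq_zero_of_two_mul_div_lt (h : IsCenterForm G l B) (D : HomDistOn G) {p : ℕ} {la : ℝ}
    {S : Set G.Pt} {V : Set (Fin p → ℝ)} {φ : (Fin p → ℝ) → G.Pt}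
    (hφ : IsHolderChart G.n p la S V φ) (hla : la ∈ Ioc (0 : ℝ) 1) {t : Fin p → ℝ} {ρ : ℝ}
    (hρ : 0 ≤ ρ) (hK : Metric.closedBall t ρ ⊆ V) {q : ℝ} (hq : 0 < q)
    (hpq : 2 * p / (1 + la) < q) :
    hContent D.d q hq (φ '' {s ∈ Metric.closedBall t ρ | φ s ∈ G.charSet p S}) = 0 := by
  obtain ⟨hla0, hla1⟩ := hla
  obtain ⟨L, H, hL, hH, hlip, hvert⟩ := h.exists_vertical_le hφ hla0.le hK
  obtain ⟨C, hC, hdist⟩ := h.exists_dist_le D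
  set c : ℝ := L + H with hc
  have hc1 : 1 ≤ c := by linarith
  set T := {s ∈ Metric.closedBall t ρ | φ s ∈ G.charSet p S} with hT
  have he : 0 < (1 + la) / 2 * q - p := by
    rw [div_lt_iff₀ (by linarith)] at hpq
    linarith
  refine ENNReal.eq_zero_of_le_rpow (C := (2 * ρ + 1) ^ p * (C * c) ^ q) he fun r hr hr1 => ?_
  set ε : ℝ := r ^ ((1 + la) / 2) with hε
  have hε0 : 0 < ε := by positivity
  have hrε : r ≤ ε := by
    simpa using Real.rpow_le_rpow_of_exponent_ge hr hr1 (show (1 + la) / 2 ≤ 1 by linarith)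
  have hε2 : ε ^ 2 = r ^ (1 + la) := by
    rw [hε, ← Real.rpow_natCast, ← Real.rpow_mul hr.le]
    norm_num
  have hpiece : ∀ U ⊆ T, (∀ s ∈ U, ∀ s' ∈ U, ‖s - s'‖ ≤ r) →
      OuterMeasure.comap φ (hContent D.d q hq) U ≤ ENNReal.ofReal ((C * (c * ε)) ^ q) := by
    intro U hU hosc
    rw [OuterMeasure.comap_apply]
    refine hContent_image_le hq (by positivity) fun s hs s' hs' => ?_
    refine hdist _ (by positivity) _ _ ?_ ?_
    · calc ‖φ s' - φ s‖ ≤ L * ‖s' - s‖ := hlip s (hU hs).1 s' (hU hs').1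
        _ ≤ c * ε := by
          gcongr
          · linarith
          · exact (hosc s' hs' s hs).trans hrε
    · calc |(φ s' - φ s) l - B (φ s) (φ s' - φ s)| ≤ H * ‖s' - s‖ ^ (1 + la) :=
            hvert s (hU hs).1 (hU hs).2 s' (hU hs').1
        _ ≤ H * r ^ (1 + la) := by
          gcongr
          exact hosc s' hs' s hs
        _ ≤ c ^ 2 * r ^ (1 + la) := by
          gcongr
          nlinarith
        _ = (c * ε) ^ 2 := by rw [mul_pow, hε2]
  have hmain := OuterMeasure.le_of_small_oscillation (OuterMeasure.comap φ (hContent D.d q hq))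
    (U := T) (f := id) (c := t) hr hρ (fun s hs => by simpa [dist_eq_norm] using hs.1) hpiece
  rw [OuterMeasure.comap_apply, ← ENNReal.ofReal_mul (by positivity)] at hmain
  refine hmain.trans (ENNReal.ofReal_le_ofReal ?_)
  have h1 := div_add_one_pow_le p hρ hr hr1
  have h2 : (C * (c * ε)) ^ q = (C * c) ^ q * r ^ ((1 + la) / 2 * q) := by
    rw [← mul_assoc, Real.mul_rpow (by positivity) hε0.le, hε, ← Real.rpow_mul hr.le]
  rw [h2, Real.rpow_sub hr, Real.rpow_natCast]
  calc _ ≤ (2 * ρ + 1) ^ p * (r ^ p)⁻¹ * ((C * c) ^ q * r ^ ((1 + la) / 2 * q)) := by gcongr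
    _ = _ := by rw [div_eq_mul_inv]; ring

/-- Nullity in every dimension above `p+1-λ`, by covering the characteristic set with images of
small pieces of the parameter domain, each subdivided further in the vertical direction. -/
lemma hContent_eq_zero_of_add_one_sub_lt (h : IsCenterForm G l B) (D : HomDistOn G) {p : ℕ} {la : ℝ}
    {S : Set G.Pt} {V : Set (Fin p → ℝ)} {φ : (Fin p → ℝ) → G.Pt}
    (hφ : IsHolderChart G.n p la S V φ) (hla : la ∈ Ioc (0 : ℝ) 1) {t : Fin p → ℝ} {ρ : ℝ}
    (hρ : 0 ≤ ρ) (hK : Metric.closedBall t ρ ⊆ V) {q : ℝ} (hq : 0 < q)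
    (hpq : p + 1 - la < q) :
    hContent D.d q hq (φ '' {s ∈ Metric.closedBall t ρ | φ s ∈ G.charSet p S}) = 0 := by
  obtain ⟨hla0, hla1⟩ := hla
  obtain ⟨L, H, hL, hH, hlip, hvert⟩ := h.exists_vertical_le hφ hla0.le hK
  obtain ⟨C, hC, hdist⟩ := h.exists_dist_le D
  set c : ℝ := L + ‖B‖ * L ^ 2 with hc
  have hBL : 0 ≤ ‖B‖ * L ^ 2 := by positivity
  have hc1 : 1 + ‖B‖ * L ^ 2 ≤ c := by linarith
  have hLc : L ≤ c := by linarith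
  set T := {s ∈ Metric.closedBall t ρ | φ s ∈ G.charSet p S} with hT
  set μ := OuterMeasure.comap φ (hContent D.d q hq) with hμ
  have he : 0 < q - (p + 1 - la) := by linarith
  refine ENNReal.eq_zero_of_le_rpow (C := (2 * ρ + 1) ^ p * (2 * H + 1) * (C * c) ^ q) he
    fun r hr hr1 => ?_
  have hpiece : ∀ U ⊆ T, (∀ s ∈ U, ∀ s' ∈ U, ‖s - s'‖ ≤ r) →
      μ U ≤ ENNReal.ofReal (2 * (H * r ^ (1 + la)) / r ^ 2 + 1) *
        ENNReal.ofReal ((C * (c * r)) ^ q) := by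
    intro U hU hosc
    rcases U.eq_empty_or_nonempty with rfl | ⟨s₀, hs₀⟩
    · simp
    let θ : (Fin p → ℝ) → ℝ := fun s => (φ s - φ s₀) l - B (φ s₀) (φ s - φ s₀)
    have hθ : ∀ s ∈ U, |θ s| ≤ H * r ^ (1 + la) := fun s hs => by
      refine (hvert s₀ (hU hs₀).1 (hU hs₀).2 s (hU hs).1).trans ?_
      gcongr
      exact hosc s hs s₀ hs₀
    have hlip' : ∀ s ∈ U, ∀ s' ∈ U, ‖φ s' - φ s‖ ≤ L * r := fun s hs s' hs' => by
      refine (hlip s (hU hs).1 s' (hU hs').1).trans ?_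
      gcongr
      exact hosc s' hs' s hs
    have hsub : ∀ U' ⊆ U, (∀ s ∈ U', ∀ s' ∈ U',
        ‖(fun _ : Fin 1 => θ s) - fun _ : Fin 1 => θ s'‖ ≤ r ^ 2) →
        μ U' ≤ ENNReal.ofReal ((C * (c * r)) ^ q) := by
      intro U' hU' hosc'
      rw [hμ, OuterMeasure.comap_apply]
      refine hContent_image_le hq (by positivity) fun s hs s' hs' => ?_
      have hss := hlip' s (hU' hs) s' (hU' hs')
      have hs0s := hlip' s₀ hs₀ s (hU' hs)
      refine hdist _ (by positivity) _ _ (hss.trans (by gcongr)) ?_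
      have h1 : |θ s' - θ s| ≤ r ^ 2 := by
        simpa using (norm_le_pi_norm _ (0 : Fin 1)).trans (hosc' s' hs' s hs)
      have h2 : |B (φ s - φ s₀) (φ s' - φ s)| ≤ ‖B‖ * (L * r) * (L * r) := by
        refine (B.le_opNorm₂ _ _).trans ?_
        gcongr
      rw [h.vertical_sub_eq (φ s₀)]
      calc |θ s' - θ s - B (φ s - φ s₀) (φ s' - φ s)|
          ≤ |θ s' - θ s| + |B (φ s - φ s₀) (φ s' - φ s)| := abs_sub _ _
        _ ≤ r ^ 2 + ‖B‖ * (L * r) * (L * r) := add_le_add h1 h2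
        _ = (1 + ‖B‖ * L ^ 2) * r ^ 2 := by ring
        _ ≤ c ^ 2 * r ^ 2 := by
          gcongr
          nlinarith
        _ = (c * r) ^ 2 := by ring
    have := OuterMeasure.le_of_small_oscillation μ (U := U) (f := fun s _ => θ s)
      (c := (0 : Fin 1 → ℝ)) (ρ := H * r ^ (1 + la)) (pow_pos hr 2) (by positivity)
      (fun s hs => (pi_norm_le_iff_of_nonneg (by positivity)).2 fun i => by simpa using hθ s hs)
      hsub
    rwa [pow_one] at this
  have hmain := OuterMeasure.le_of_small_oscillation μ
    (U := T) (f := id) (c := t) hr hρ (fun s hs => by simpa [dist_eq_norm] using hs.1) hpiece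
  rw [hμ, OuterMeasure.comap_apply, ← ENNReal.ofReal_mul (by positivity),
    ← ENNReal.ofReal_mul (by positivity)] at hmain
  refine hmain.trans (ENNReal.ofReal_le_ofReal ?_)
  have h1 := div_add_one_pow_le p hρ hr hr1
  have h2 : (C * (c * r)) ^ q = (C * c) ^ q * r ^ q := by
    rw [← mul_assoc, Real.mul_rpow (by positivity) hr.le]
  have h3 : 2 * (H * r ^ (1 + la)) / r ^ 2 + 1 ≤ (2 * H + 1) * r ^ (la - 1) := by
    have h4 : r ^ (1 + la) / r ^ 2 = r ^ (la - 1) := by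
      rw [← Real.rpow_natCast, ← Real.rpow_sub hr]
      congr 1
      push_cast
      ring
    have h5 : 1 ≤ r ^ (la - 1) :=
      Real.one_le_rpow_of_pos_of_le_one_of_nonpos hr hr1 (by linarith)
    have h6 : 2 * (H * r ^ (1 + la)) / r ^ 2 = 2 * H * (r ^ (1 + la) / r ^ 2) := by ring
    rw [h6, h4]
    linarith
  have h7 : r ^ (q - (p + 1 - la)) = (r ^ p)⁻¹ * (r ^ (la - 1) * r ^ q) := by
    rw [← Real.rpow_natCast, ← Real.rpow_neg hr.le, ← Real.rpow_add hr, ← Real.rpow_add hr]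
    congr 1
    ring
  rw [h2, h7]
  calc _ ≤ (2 * ρ + 1) ^ p * (r ^ p)⁻¹ *
        ((2 * H + 1) * r ^ (la - 1) * ((C * c) ^ q * r ^ q)) := by gcongr
    _ = _ := by ring

end IsCenterForm

/-- If the characteristic set is null in every compact piece of every chart, it is null. -/
lemma hContent_charSet_eq_zero_of_charts {G : StratifiedGroup} {p : ℕ} {la : ℝ} {S : Set G.Pt}
    (hS : IsC1HolderSubmanifold G.n p la S) {μ : OuterMeasure G.Pt}
    (hμ : ∀ V φ, IsHolderChart G.n p la S V φ → ∀ t ρ, 0 ≤ ρ → Metric.closedBall t ρ ⊆ V →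
      μ (φ '' {s ∈ Metric.closedBall t ρ | φ s ∈ G.charSet p S}) = 0) :
    μ (G.charSet p S) = 0 := by
  refine measure_null_of_locally_null _ fun x hx => ?_
  obtain ⟨V, φ, hφ, t, ht, rfl⟩ := hS x hx.1
  obtain ⟨ρ, hρ, hball⟩ := Metric.nhds_basis_closedBall.mem_iff.1 (hφ.1.1.mem_nhds ht)
  obtain ⟨O, hO, himg⟩ := hφ.1.2.2.2.2 (Metric.ball t ρ)
    (Metric.ball_subset_closedBall.trans hball) Metric.isOpen_ball
  have hxO : φ t ∈ S ∩ O := himg ▸ mem_image_of_mem φ (Metric.mem_ball_self hρ)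
  refine ⟨G.charSet p S ∩ O, inter_mem_nhdsWithin _ (hO.mem_nhds hxO.2),
    measure_mono_null ?_ (hμ V φ hφ t ρ hρ.le hball)⟩
  rintro y ⟨hyc, hyO⟩
  obtain ⟨s, hs, rfl⟩ : y ∈ φ '' Metric.ball t ρ := himg ▸ ⟨hyc.1, hyO⟩
  exact ⟨s, ⟨Metric.ball_subset_closedBall hs, hyc⟩, rfl⟩

/-- **Characteristic sets in Heisenberg groups (Remark 5.4).**
Let `ℍⁿ` be the Heisenberg group with a homogeneous distance `d`, let `λ ∈ (0,1]` and
let `Σ ⊆ ℍⁿ` be a `p`-dimensional submanifold of class `C^{1,λ}` with generalized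
characteristic set `Σ_c`.  If `2 ≤ p ≤ 2n` then `dim_H Σ_c ≤ p + 1 - λ`; if `p = 1`
then `dim_H Σ_c ≤ 2/(1+λ) ≤ 2 - λ`. -/
theorem statement19 (G : StratifiedGroup) (n : ℕ) (hn : 0 < n)
    (hH : IsHeisenberg G n) (D : HomDistOn G) (p : ℕ) (la : ℝ)
    (hla : la ∈ Set.Ioc (0 : ℝ) 1) (S : Set G.Pt)
    (hS : IsC1HolderSubmanifold G.n p la S) :
    (2 ≤ p → p ≤ 2 * n →
      hDim D.d (G.charSet p S) ≤ ENNReal.ofReal ((p : ℝ) + 1 - la)) ∧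
    (p = 1 →
      hDim D.d (G.charSet p S) ≤ ENNReal.ofReal (2 / (1 + la)) ∧
        2 / (1 + la) ≤ 2 - la) := by
  obtain ⟨hla0, hla1⟩ := hla
  obtain ⟨l, B, hB⟩ := hH.exists_isCenterForm
  refine ⟨fun hp _ => ?_, ?_⟩
  · have hp' : (2 : ℝ) ≤ p := by exact_mod_cast hp
    exact hDim_le_of_hContent (by linarith) fun q hq hlt =>
      hContent_charSet_eq_zero_of_charts hS fun V φ hφ t ρ hρ hball =>
        hB.hContent_eq_zero_of_add_one_sub_lt D hφ ⟨hla0, hla1⟩ hρ hball hq hlt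
  · rintro rfl
    refine ⟨hDim_le_of_hContent (by positivity) fun q hq hlt =>
      hContent_charSet_eq_zero_of_charts hS fun V φ hφ t ρ hρ hball =>
        hB.hContent_eq_zero_of_two_mul_div_lt D hφ ⟨hla0, hla1⟩ hρ hball hq (by simpa using hlt), ?_⟩
    rw [div_le_iff₀ (by linarith)]
    nlinarith
end
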